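/- There exist constants c > 0, K > 0 and n₀ ∈ ℕ such that for every integer n ≥ n₀ and every node v₀ ∈ Fin n, after ⌈2c·n·log n⌉ steps (i.e., 2c·log n periods) of the push–pull broadcast started from the single informed node v₀, at least c·log n nodes are informed with probability at least 1 − K·(log n)²/n: μ_n({ω : |I_ω^{{v₀}}(⌈2c·n·log n⌉)| ≥ c·log n}) ≥ 1 − K·(log n)²/n. -/

import Mathlib

open MeasureTheory ProbabilityTheory

noncomputable section

/-- The uniform probability measure on the set of ordered pairs of distinct nodes. -/
def pairUniform (n : ℕ) : Measure (Fin n × Fin n) :=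
  uniformOn {p : Fin n × Fin n | p.1 ≠ p.2}

/-- `μ` is the random-scheduler measure `μ_n`: it is a probability measure on the sequence
space `(Fin n × Fin n)^ℕ` under which the coordinate maps (the pairs selected at each time
step) are mutually independent and each is uniformly distributed on the set of ordered pairs
of distinct nodes, i.e. `μ` is the countable product of the uniform measure on that set. -/
def IsSchedulerMeasure (n : ℕ) (μ : Measure (ℕ → Fin n × Fin n)) : Prop :=
  IsProbabilityMeasure μ ∧
  iIndepFun (fun t (ω : ℕ → Fin n × Fin n) => ω t) μ ∧
  ∀ t : ℕ, Measure.map (fun ω => ω t) μ = pairUniform n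

/-- The informed set `I_ω^S(t)` of the push–pull broadcast: starting from `S`, whenever the
selected pair contains an informed node, both nodes of the pair become informed. -/
def informed (n : ℕ) (ω : ℕ → Fin n × Fin n) (S : Finset (Fin n)) : ℕ → Finset (Fin n)
  | 0 => S
  | t + 1 =>
      let I := informed n ω S t
      if (ω t).1 ∈ I ∨ (ω t).2 ∈ I then insert (ω t).1 (insert (ω t).2 I) else I

def stepI (n : ℕ) (I : Finset (Fin n)) (p : Fin n × Fin n) : Finset (Fin n) :=
  if p.1 ∈ I ∨ p.2 ∈ I then insert p.1 (insert p.2 I) else I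

def wI (n : ℕ) (A : Finset (Fin n)) : ℝ :=
  if A = Finset.univ then 0 else (1 / 2 : ℝ) ^ A.card

lemma wI_nonneg (n : ℕ) (A : Finset (Fin n)) : 0 ≤ wI n A := by
  unfold wI; split_ifs <;> positivity

lemma informed_succ (n : ℕ) (ω : ℕ → Fin n × Fin n) (S : Finset (Fin n)) (t : ℕ) :
    informed n ω S (t + 1) = stepI n (informed n ω S t) (ω t) := rfl

lemma informed_congr (n : ℕ) (ω ω' : ℕ → Fin n × Fin n) (S : Finset (Fin n)) (t : ℕ)
    (h : ∀ s < t, ω s = ω' s) : informed n ω S t = informed n ω' S t := by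
  induction t with
  | zero => rfl
  | succ t ih =>
    rw [informed_succ, informed_succ, ih (fun s hs => h s (by omega)), h t (by omega)]

lemma subset_stepI (n : ℕ) (A : Finset (Fin n)) (p : Fin n × Fin n) : A ⊆ stepI n A p := by
  unfold stepI
  split_ifs
  · exact (Finset.subset_insert _ _).trans (Finset.subset_insert _ _)
  · exact subset_rfl

lemma informed_nonempty (n : ℕ) (ω : ℕ → Fin n × Fin n) (S : Finset (Fin n)) (hS : S.Nonempty)
    (t : ℕ) : (informed n ω S t).Nonempty := by
  induction t with
  | zero => exact hS
  | succ t ih => exact ih.mono (subset_stepI n _ _)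

lemma wI_anti (n : ℕ) (A B : Finset (Fin n)) (h : A ⊆ B) : wI n B ≤ wI n A := by
  by_cases hB : B = Finset.univ
  · simp only [wI, hB, if_true]; exact wI_nonneg n A
  · have hA : A ≠ Finset.univ := by
      rintro rfl; exact hB (Finset.univ_subset_iff.1 h)
    simp only [wI, hA, hB, if_false]
    exact pow_le_pow_of_le_one (by norm_num) (by norm_num) (Finset.card_le_card h)

lemma wI_half (n : ℕ) (A B : Finset (Fin n)) (h : A ⊂ B) : wI n B ≤ wI n A / 2 := by
  by_cases hB : B = Finset.univ
  · have := wI_nonneg n A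
    simp only [wI, hB, if_true] at *; linarith
  · have hA : A ≠ Finset.univ := by
      rintro rfl; exact hB (Finset.univ_subset_iff.1 h.1)
    simp only [wI, hA, hB, if_false]
    have := Finset.card_lt_card h
    calc (1 / 2 : ℝ) ^ B.card ≤ (1 / 2 : ℝ) ^ (A.card + 1) :=
          pow_le_pow_of_le_one (by norm_num) (by norm_num) this
      _ = _ := by ring

def crossI (n : ℕ) (A : Finset (Fin n)) : Finset (Fin n × Fin n) :=
  (A ×ˢ Aᶜ) ∪ (Aᶜ ×ˢ A)

lemma crossI_step (n : ℕ) (A : Finset (Fin n)) (p : Fin n × Fin n) (hp : p ∈ crossI n A) :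
    A ⊂ stepI n A p := by
  refine ⟨subset_stepI n A p, fun h => ?_⟩
  simp only [crossI, Finset.mem_union, Finset.mem_product, Finset.mem_compl] at hp
  have h1 : p.1 ∈ A ∨ p.2 ∈ A := by tauto
  rw [stepI, if_pos h1] at h
  have a := h (Finset.mem_insert_self _ _)
  have b := h (Finset.mem_insert_of_mem (Finset.mem_insert_self _ _))
  tauto

lemma card_crossI (n : ℕ) (A : Finset (Fin n)) :
    (crossI n A).card = 2 * (A.card * (n - A.card)) := by
  rw [crossI, Finset.card_union_of_disjoint]
  · simp [Finset.card_product, Finset.card_compl]; ring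
  · rw [Finset.disjoint_left]
    intro p hp hq
    simp only [Finset.mem_product, Finset.mem_compl] at hp hq
    tauto

lemma card_offDiag' (n : ℕ) :
    ((Finset.univ : Finset (Fin n × Fin n)).filter (fun p => p.1 ≠ p.2)).card = n * n - n := by
  have h := Finset.offDiag_card (Finset.univ : Finset (Fin n))
  rw [Finset.card_univ, Fintype.card_fin] at h
  rw [← h]; congr 1; ext p; simp [Finset.mem_offDiag]

lemma pairUniform_cross (n : ℕ) (hn : 2 ≤ n) (A : Finset (Fin n)) (hA : A.Nonempty)
    (hA' : A ≠ Finset.univ) :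
    ENNReal.ofReal (2 / n) ≤ pairUniform n (crossI n A : Set (Fin n × Fin n)) := by
  have hset : {p : Fin n × Fin n | p.1 ≠ p.2} =
      (((Finset.univ : Finset (Fin n × Fin n)).filter (fun p => p.1 ≠ p.2)) : Finset _) := by
    ext p; simp
  have hsub : {p : Fin n × Fin n | p.1 ≠ p.2} ∩ (crossI n A : Set (Fin n × Fin n)) =
      (crossI n A : Set (Fin n × Fin n)) := by
    apply Set.inter_eq_right.2
    intro p hp
    simp only [crossI, Finset.coe_union, Finset.coe_product, Finset.coe_compl, Set.mem_union,
      Set.mem_prod, Finset.mem_coe, Set.mem_compl_iff] at hp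
    simp only [Set.mem_setOf_eq]
    intro h
    rw [h] at hp
    tauto
  rw [pairUniform, uniformOn, cond_apply (Set.toFinite _).measurableSet, hsub, hset,
    Measure.count_apply_finset, Measure.count_apply_finset, card_offDiag', card_crossI]
  have hk1 : 1 ≤ A.card := hA.card_pos
  have hk2 : A.card + 1 ≤ n := by
    have := Finset.card_lt_univ_of_notMem (s := A) (x := (by
      exact Classical.choose (not_forall.1 (fun h => hA' (Finset.eq_univ_iff_forall.2 h)))))
      (Classical.choose_spec (not_forall.1 (fun h => hA' (Finset.eq_univ_iff_forall.2 h))))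
    rw [Fintype.card_fin] at this; omega
  generalize A.card = k at hk1 hk2
  obtain ⟨j, rfl⟩ := Nat.exists_eq_add_of_le hk1
  obtain ⟨i, rfl⟩ := Nat.exists_eq_add_of_le hk2
  have e1 : 1 + j + 1 + i - (1 + j) = 1 + i := by omega
  have e2 : (1 + j + 1 + i) * (1 + j + 1 + i) - (1 + j + 1 + i)
      = (1 + j + 1 + i) * (1 + j + i) := by
    rw [Nat.sub_eq_iff_eq_add (Nat.le_mul_self _)]; ring
  rw [e1, e2]
  have hpos : (0 : ℝ) < (((1 + j + 1 + i) * (1 + j + i) : ℕ) : ℝ) := by positivity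
  rw [← ENNReal.ofReal_natCast, ← ENNReal.ofReal_natCast, ← ENNReal.ofReal_inv_of_pos hpos,
    ← ENNReal.ofReal_mul (by positivity)]
  apply ENNReal.ofReal_le_ofReal
  rw [inv_mul_eq_div, div_le_div_iff₀ (by positivity) hpos]
  push_cast
  have hj : (0 : ℝ) ≤ j := by positivity
  have hi : (0 : ℝ) ≤ i := by positivity
  have hij : (0 : ℝ) ≤ (j : ℝ) * i := by positivity
  have hm : (0 : ℝ) ≤ 1 + j + 1 + i := by positivity
  nlinarith [mul_nonneg hm hij]

lemma inner_bound (n : ℕ) (hn : 2 ≤ n) [IsProbabilityMeasure (pairUniform n)]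
    (A : Finset (Fin n)) (hA : A.Nonempty) :
    ∫⁻ p, ENNReal.ofReal (wI n (stepI n A p)) ∂(pairUniform n) ≤
      ENNReal.ofReal (1 - 1 / n) * ENNReal.ofReal (wI n A) := by
  have hw := wI_nonneg n A
  by_cases hA' : A = Finset.univ
  · have : ∀ p, wI n (stepI n A p) = 0 := fun p => by
      have h := subset_stepI n A p
      rw [hA', Finset.univ_subset_iff] at h
      rw [hA', h]; simp [wI]
    simp [this]
  have hn0 : (2 : ℝ) ≤ n := by exact_mod_cast hn
  have hn1 : 1 / (n : ℝ) ≤ 1 := by rw [div_le_one (by linarith)]; linarith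
  have key : ∫⁻ p, ENNReal.ofReal (wI n (stepI n A p)) ∂(pairUniform n) +
      ENNReal.ofReal (wI n A / 2) * pairUniform n (crossI n A : Set (Fin n × Fin n)) ≤
      ENNReal.ofReal (wI n A) := by
    rw [← lintegral_indicator_const (Set.toFinite _).measurableSet,
      ← lintegral_add_left (measurable_of_finite _)]
    calc _ ≤ ∫⁻ p, ENNReal.ofReal (wI n A) ∂(pairUniform n) := by
          apply lintegral_mono
          intro p
          by_cases hp : p ∈ crossI n A
          · have := wI_half n A _ (crossI_step n A p hp)
            simp only [Set.indicator, Finset.mem_coe, hp, if_true]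
            rw [← ENNReal.ofReal_add (wI_nonneg _ _) (by positivity)]
            apply ENNReal.ofReal_le_ofReal; linarith
          · simp only [Set.indicator, Finset.mem_coe, hp, if_false, add_zero]
            exact ENNReal.ofReal_le_ofReal (wI_anti n A _ (subset_stepI n A p))
      _ = _ := by simp
  have hc := pairUniform_cross n hn A hA hA'
  have key2 : ∫⁻ p, ENNReal.ofReal (wI n (stepI n A p)) ∂(pairUniform n) +
      ENNReal.ofReal (wI n A / n) ≤ ENNReal.ofReal (wI n A) := by
    refine le_trans ?_ key
    gcongr
    calc ENNReal.ofReal (wI n A / n) = ENNReal.ofReal (wI n A / 2) * ENNReal.ofReal (2 / n) := by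
          rw [← ENNReal.ofReal_mul (by positivity)]; congr 1; field_simp
      _ ≤ _ := by gcongr
  have := ENNReal.le_sub_of_add_le_right ENNReal.ofReal_ne_top key2
  rw [← ENNReal.ofReal_sub _ (by positivity)] at this
  rw [← ENNReal.ofReal_mul (by linarith)]
  refine this.trans (ENNReal.ofReal_le_ofReal (le_of_eq (by ring)))

def extI (n t : ℕ) (d : Fin n × Fin n) (g : Finset.range t → Fin n × Fin n) :
    ℕ → Fin n × Fin n :=
  fun s => if h : s ∈ Finset.range t then g ⟨s, h⟩ else d

lemma informed_ext (n t : ℕ) (d : Fin n × Fin n) (ω : ℕ → Fin n × Fin n)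
    (S : Finset (Fin n)) :
    informed n ω S t = informed n (extI n t d (fun i => ω i)) S t := by
  apply informed_congr
  intro s hs
  simp [extI, hs]

lemma measurable_w (n t : ℕ) (S : Finset (Fin n)) (d : Fin n × Fin n) :
    Measurable (fun ω : ℕ → Fin n × Fin n => ENNReal.ofReal (wI n (informed n ω S t))) := by
  have h : (fun ω : ℕ → Fin n × Fin n => ENNReal.ofReal (wI n (informed n ω S t))) =
      (fun g : Finset.range t → Fin n × Fin n =>
        ENNReal.ofReal (wI n (informed n (extI n t d g) S t))) ∘ (fun ω i => ω i) := by
    funext ω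
    simp only [Function.comp]
    rw [informed_ext n t d ω S]
  rw [h]
  exact (measurable_of_finite _).comp (measurable_pi_lambda _ (fun i => measurable_pi_apply _))

lemma expect_step (n : ℕ) (hn : 2 ≤ n) (μ : Measure (ℕ → Fin n × Fin n))
    (hμ : IsSchedulerMeasure n μ) (S : Finset (Fin n)) (hS : S.Nonempty) (t : ℕ) :
    ∫⁻ ω, ENNReal.ofReal (wI n (informed n ω S (t + 1))) ∂μ ≤
      ENNReal.ofReal (1 - 1 / n) * ∫⁻ ω, ENNReal.ofReal (wI n (informed n ω S t)) ∂μ := by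
  obtain ⟨hP, hI, hmap⟩ := hμ
  have : IsProbabilityMeasure (pairUniform n) := by
    rw [← hmap 0]
    exact Measure.isProbabilityMeasure_map (measurable_pi_apply 0).aemeasurable
  obtain ⟨v, hv⟩ := hS
  let d : Fin n × Fin n := (v, v)
  let R : (ℕ → Fin n × Fin n) → (Finset.range t → Fin n × Fin n) := fun ω i => ω i
  have hR : Measurable R := measurable_pi_lambda _ (fun i => measurable_pi_apply _)
  have hind : IndepFun R (fun ω => ω t) μ := by
    have h := hI.indepFun_finset (Finset.range t) {t} (by simp) (fun i => measurable_pi_apply i)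
    exact h.comp (φ := id) (ψ := fun g : ({t} : Finset ℕ) → Fin n × Fin n => g ⟨t, by simp⟩)
      measurable_id (measurable_pi_apply _)
  have hprod := (indepFun_iff_map_prod_eq_prod_map_map hR.aemeasurable
    (measurable_pi_apply t).aemeasurable).1 hind
  rw [hmap t] at hprod
  let G : (Finset.range t → Fin n × Fin n) → Finset (Fin n) :=
    fun g => informed n (extI n t d g) S t
  have hG : ∀ ω, informed n ω S t = G (R ω) := fun ω => informed_ext n t d ω S
  have : IsProbabilityMeasure (μ.map R) := Measure.isProbabilityMeasure_map hR.aemeasurable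
  calc ∫⁻ ω, ENNReal.ofReal (wI n (informed n ω S (t + 1))) ∂μ
      = ∫⁻ ω, (fun q : (Finset.range t → Fin n × Fin n) × (Fin n × Fin n) =>
          ENNReal.ofReal (wI n (stepI n (G q.1) q.2))) (R ω, ω t) ∂μ := by
        simp only [informed_succ, hG]
    _ = ∫⁻ q, ENNReal.ofReal (wI n (stepI n (G q.1) q.2)) ∂((μ.map R).prod (pairUniform n)) := by
        rw [← hprod, lintegral_map (measurable_of_finite _)
          (hR.prodMk (measurable_pi_apply t))]
    _ = ∫⁻ g, ∫⁻ p, ENNReal.ofReal (wI n (stepI n (G g) p)) ∂(pairUniform n) ∂(μ.map R) := by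
        rw [lintegral_prod _ (measurable_of_finite _).aemeasurable]
    _ ≤ ∫⁻ g, ENNReal.ofReal (1 - 1 / n) * ENNReal.ofReal (wI n (G g)) ∂(μ.map R) :=
        lintegral_mono fun g => inner_bound n hn _ (informed_nonempty n _ S ⟨v, hv⟩ t)
    _ = ENNReal.ofReal (1 - 1 / n) * ∫⁻ ω, ENNReal.ofReal (wI n (informed n ω S t)) ∂μ := by
        rw [lintegral_const_mul _ (measurable_of_finite _),
          lintegral_map (measurable_of_finite _) hR]
        simp only [hG]

lemma expect_bound (n : ℕ) (hn : 2 ≤ n) (μ : Measure (ℕ → Fin n × Fin n))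
    (hμ : IsSchedulerMeasure n μ) (S : Finset (Fin n)) (hS : S.Nonempty) (t : ℕ) :
    ∫⁻ ω, ENNReal.ofReal (wI n (informed n ω S t)) ∂μ ≤
      ENNReal.ofReal (1 - 1 / n) ^ t := by
  induction t with
  | zero =>
    have := hμ.1
    calc _ ≤ ∫⁻ ω, 1 ∂μ := by
          apply lintegral_mono
          intro ω
          simp only [ENNReal.ofReal_le_one]
          unfold wI
          split_ifs
          · norm_num
          · exact pow_le_one₀ (by norm_num) (by norm_num)
      _ = _ := by simp
  | succ t ih =>
    refine (expect_step n hn μ hμ S hS t).trans ?_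
    rw [pow_succ']
    gcongr

/-- There exist constants `c > 0`, `K > 0` and `n₀` such that for every `n ≥ n₀` and every
node `v₀`, after `⌈2c·n·log n⌉` steps of the push–pull broadcast started from the single
informed node `v₀`, at least `c·log n` nodes are informed with probability at least
`1 − K·(log n)²/n`. -/
theorem pushPull_informs_clogn_nodes :
    ∃ (c K : ℝ) (n₀ : ℕ), 0 < c ∧ 0 < K ∧
      ∀ n : ℕ, n₀ ≤ n →
        ∀ μ : Measure (ℕ → Fin n × Fin n), IsSchedulerMeasure n μ →
          ∀ v₀ : Fin n,
            μ {ω | c * Real.log n ≤ ((informed n ω {v₀} ⌈2 * c * n * Real.log n⌉₊).card : ℝ)} ≥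
              1 - ENNReal.ofReal (K * (Real.log n) ^ 2 / n) := by
  refine ⟨1, 1, 3, one_pos, one_pos, ?_⟩
  intro n hn μ hμ v₀
  have hP := hμ.1
  have hn3 : (3 : ℝ) ≤ n := by exact_mod_cast hn
  have hn0 : (0 : ℝ) < n := by linarith
  have hL : 1 ≤ Real.log n := by
    rw [Real.le_log_iff_exp_le hn0]
    linarith [Real.exp_one_lt_d9]
  set T := ⌈2 * 1 * n * Real.log n⌉₊ with hT
  have hTr : 2 * n * Real.log n ≤ T := by
    have := Nat.le_ceil (2 * 1 * n * Real.log n)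
    rw [← hT] at this; linarith
  set s := {ω | 1 * Real.log n ≤ ((informed n ω {v₀} T).card : ℝ)} with hs
  have hE := expect_bound n (by omega) μ hμ {v₀} (Finset.singleton_nonempty _) T
  have hn1 : 0 ≤ 1 - 1 / (n : ℝ) := by
    rw [sub_nonneg, div_le_one hn0]; linarith
  have hpow : (1 - 1 / (n : ℝ)) ^ T ≤ 1 / (n : ℝ) ^ 2 := by
    calc (1 - 1 / (n : ℝ)) ^ T ≤ (Real.exp (-(1 / (n : ℝ)))) ^ T := by
          apply pow_le_pow_left₀ hn1
          have := Real.add_one_le_exp (-(1 / (n : ℝ)))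
          linarith
      _ = Real.exp (-(T / (n : ℝ))) := by
          rw [← Real.exp_nat_mul]; congr 1; ring
      _ ≤ Real.exp (-(2 * Real.log n)) := by
          apply Real.exp_le_exp.2
          rw [neg_le_neg_iff, le_div_iff₀ hn0]; linarith
      _ = 1 / (n : ℝ) ^ 2 := by
          rw [Real.exp_neg, two_mul, Real.exp_add, Real.exp_log hn0]
          field_simp
  have hsub : sᶜ ⊆ {ω | ENNReal.ofReal (1 / n) ≤
      ENNReal.ofReal (wI n (informed n ω {v₀} T))} := by
    intro ω hω
    simp only [hs, Set.mem_compl_iff, Set.mem_setOf_eq, not_le, one_mul] at hω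
    apply ENNReal.ofReal_le_ofReal
    have hne : informed n ω {v₀} T ≠ Finset.univ := by
      intro h
      rw [h, Finset.card_univ, Fintype.card_fin] at hω
      linarith [Real.log_le_sub_one_of_pos hn0]
    rw [wI, if_neg hne]
    set k := (informed n ω {v₀} T).card
    have h2 : (2 : ℝ) ^ k ≤ n := by
      calc (2 : ℝ) ^ k ≤ Real.exp 1 ^ k := by
            apply pow_le_pow_left₀ (by norm_num)
            linarith [Real.exp_one_gt_d9]
        _ = Real.exp k := by rw [← Real.exp_nat_mul, mul_one]
        _ ≤ Real.exp (Real.log n) := Real.exp_le_exp.2 hω.le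
        _ = n := Real.exp_log hn0
    rw [one_div_pow]
    exact one_div_le_one_div_of_le (by positivity) h2
  have hmk := mul_meas_ge_le_lintegral (μ := μ) (measurable_w n T {v₀} (v₀, v₀))
    (ENNReal.ofReal (1 / n))
  have hfail : μ sᶜ ≤ ENNReal.ofReal (1 * Real.log n ^ 2 / n) := by
    have h1 : ENNReal.ofReal (1 / n) * μ sᶜ ≤ ENNReal.ofReal (1 / (n : ℝ) ^ 2) := by
      calc _ ≤ _ := mul_le_mul_right (measure_mono hsub) _
        _ ≤ _ := hmk
        _ ≤ _ := hE
        _ = ENNReal.ofReal ((1 - 1 / (n : ℝ)) ^ T) := by rw [ENNReal.ofReal_pow hn1]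
        _ ≤ _ := ENNReal.ofReal_le_ofReal hpow
    have h2 : μ sᶜ = ENNReal.ofReal n * (ENNReal.ofReal (1 / n) * μ sᶜ) := by
      rw [← mul_assoc, ← ENNReal.ofReal_mul hn0.le, mul_one_div_cancel hn0.ne']
      simp
    rw [h2]
    calc _ ≤ ENNReal.ofReal n * ENNReal.ofReal (1 / (n : ℝ) ^ 2) := by gcongr
      _ = ENNReal.ofReal (1 / n) := by
          rw [← ENNReal.ofReal_mul hn0.le]; congr 1; field_simp
      _ ≤ _ := by
          apply ENNReal.ofReal_le_ofReal
          gcongr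
          nlinarith
  rw [ge_iff_le, tsub_le_iff_right]
  calc (1 : ENNReal) = μ Set.univ := by simp
    _ ≤ μ s + μ sᶜ := by
        rw [← Set.union_compl_self s]; exact measure_union_le _ _
    _ ≤ _ := by gcongr

end
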